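/- arXiv:2008.03267 — 5 statements merged into one kernel-verified Lean document; each statement's English description precedes it below -/
import Mathlib

section
/- Let G be a gyrogroup, and let S ⊆ G be a symmetric subset with e ∉ S. If gyr[g,s] is the identity map on G for every g ∈ G and every s ∈ S, then the left Cayley graph LCay(G,S) is vertex-transitive: for any two vertices u, v ∈ G there exists a bijection φ : G → G with φ(u) = v such that for all x, y ∈ G, y is adjacent to x in LCay(G,S) if and only if φ(y) is adjacent to φ(x). -/
/-- A gyrogroup: a set `G` with a binary operation `add` (⊕), an identity `e`,
an inverse operation `neg` (⊖), and for each pair `a b : G` a gyroautomorphism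
`gyr a b : G → G`, satisfying the gyrogroup axioms. -/
class Gyrogroup (G : Type*) where
  add : G → G → G
  e : G
  neg : G → G
  gyr : G → G → G → G
  e_add : ∀ x, add e x = x
  add_e : ∀ x, add x e = x
  neg_add : ∀ x, add (neg x) x = e
  add_neg : ∀ x, add x (neg x) = e
  gyr_bijective : ∀ a b, Function.Bijective (gyr a b)
  gyr_add : ∀ a b x y, gyr a b (add x y) = add (gyr a b x) (gyr a b y)
  left_gyroassoc : ∀ a b c, add a (add b c) = add (add a b) (gyr a b c)
  left_loop : ∀ a b, gyr (add a b) b = gyr a b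

open Gyrogroup


namespace Gyrogroup

variable {G : Type*} [Gyrogroup G]

theorem add_left_cancel {a x y : G} (h : add a x = add a y) : x = y := by
  apply (gyr_bijective (neg a) a).injective
  have h' := congrArg (add (neg a)) h
  rwa [left_gyroassoc, left_gyroassoc, neg_add, e_add, e_add] at h'

theorem gyr_e_left (b c : G) : gyr e b c = c := by
  have h := left_gyroassoc e b c
  rw [e_add, e_add] at h
  exact (add_left_cancel h).symm

theorem gyr_neg_self (a c : G) : gyr (neg a) a c = c := by
  rw [← left_loop, neg_add, gyr_e_left]

theorem gyr_self_neg (a c : G) : gyr a (neg a) c = c := by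
  rw [← left_loop, add_neg, gyr_e_left]

theorem neg_add_cancel_left (a b : G) : add (neg a) (add a b) = b := by
  rw [left_gyroassoc, neg_add, e_add, gyr_neg_self]

theorem add_neg_cancel_left (a b : G) : add a (add (neg a) b) = b := by
  rw [left_gyroassoc, add_neg, e_add, gyr_self_neg]

theorem gyr_e_right (a b : G) : gyr a b e = e := by
  apply add_left_cancel (a := gyr a b e)
  rw [← gyr_add, add_e, add_e]

theorem gyr_neg (a b x : G) : gyr a b (neg x) = neg (gyr a b x) := by
  apply add_left_cancel (a := gyr a b x)
  rw [← gyr_add, add_neg, add_neg, gyr_e_right]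

/-- The right cancellation law. -/
theorem add_add_neg_gyr (a b : G) : add (add a b) (neg (gyr a b b)) = a := by
  rw [← gyr_neg, ← left_gyroassoc, add_neg, add_e]

/-- The nested gyration identity. -/
theorem gyr_neg_gyr_gyr (a b c : G) : gyr a (neg (gyr a b b)) (gyr a b c) = c := by
  apply add_left_cancel (a := a)
  have h := left_gyroassoc (add a b) (neg (gyr a b b)) (gyr a b c)
  rw [← left_loop (add a b), add_add_neg_gyr, ← gyr_neg, ← gyr_add, ← left_gyroassoc,
    add_neg_cancel_left, gyr_neg] at h
  exact h.symm

theorem add_neg_gyr_add (a b : G) : add (add a (neg (gyr a b b))) b = a := by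
  have h := left_gyroassoc a (neg (gyr a b b)) (gyr a b b)
  rw [neg_add, add_e, gyr_neg_gyr_gyr] at h
  exact h.symm

theorem add_right_bijective (b : G) : Function.Bijective fun x : G => add x b := by
  refine ⟨fun x y h => ?_, fun c => ⟨_, add_neg_gyr_add c b⟩⟩
  dsimp only at h
  rw [← add_add_neg_gyr x b, ← add_add_neg_gyr y b, ← left_loop x, ← left_loop y, h]

theorem gyr_add_gyr (a b c : G) : gyr b (add a b) (gyr a b c) = c := by
  have h := left_gyroassoc (neg a) (add a b) (gyr a b c)
  rw [← left_gyroassoc, neg_add_cancel_left, neg_add_cancel_left,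
    ← left_loop (neg a), neg_add_cancel_left] at h
  exact (add_left_cancel h).symm

/-- Inversive symmetry of gyrations. -/
theorem gyr_gyr_swap (a b c : G) : gyr b a (gyr a b c) = c := by
  obtain ⟨x, rfl⟩ := (add_right_bijective b).surjective a
  rw [left_loop, gyr_add_gyr]

end Gyrogroup

/-- If `S` is symmetric, `e ∉ S`, and `gyr g s` is the identity map for every
`g ∈ G` and `s ∈ S`, then the left Cayley graph `LCay(G,S)` is vertex-transitive. -/
theorem lcay_transitive_of_gyr_id {G : Type*} [Gyrogroup G] (S : Set G)
    (hsym : ∀ s ∈ S, neg s ∈ S) (he : (e : G) ∉ S)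
    (hgyr : ∀ g : G, ∀ s ∈ S, ∀ x : G, gyr g s x = x) :
    ∀ u v : G, ∃ φ : G → G, Function.Bijective φ ∧ φ u = v ∧
      ∀ x y : G, (∃ s ∈ S, y = add s x) ↔ (∃ s ∈ S, φ y = add s (φ x)) := by
  intro u v
  have assoc (s : G) (hs : s ∈ S) (x w : G) : add (add s x) w = add s (add x w) := by
    have h : gyr s x w = w := by
      simpa only [hgyr x s hs] using gyr_gyr_swap x s w
    rw [left_gyroassoc, h]
  have hbij := add_right_bijective (add (neg u) v)
  refine ⟨fun x => add x (add (neg u) v), hbij, add_neg_cancel_left u v, fun x y => ?_⟩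
  refine exists_congr fun s => and_congr_right fun hs => ?_
  dsimp only
  rw [← assoc s hs]
  exact hbij.injective.eq_iff.symm
end

section
/- Let G be a gyrogroup and let S ⊆ G be a symmetric subset with e ∉ S. If gyr[g,s](S) = S for all g ∈ G and s ∈ S, then the right Cayley graph RCay(G,S) is undirected: whenever there is an edge u → v (i.e., v = u ⊕ s for some s ∈ S), there is also an edge v → u (i.e., u = v ⊕ s' for some s' ∈ S). -/
open Gyrogroup


/-- If `S` is symmetric, `e ∉ S`, and `gyr g s '' S = S` for all `s ∈ S` and
`g ∈ G`, then the right Cayley graph `RCay(G,S)` is undirected. -/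
theorem rcay_undirected_of_gyr_stable {G : Type*} [Gyrogroup G] (S : Set G)
    (hsym : ∀ s ∈ S, neg s ∈ S) (he : (e : G) ∉ S)
    (hgyr : ∀ g : G, ∀ s ∈ S, gyr g s '' S = S) :
    ∀ u v : G, (∃ s ∈ S, v = add u s) → ∃ s' ∈ S, u = add v s' := by
  rintro u _ ⟨s, hs, rfl⟩
  refine ⟨gyr u s (neg s), ?_, ?_⟩
  · have h := Set.mem_image_of_mem (gyr u s) (hsym s hs)
    rwa [hgyr u s hs] at h
  · rw [← left_gyroassoc, Gyrogroup.add_neg, add_e]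
end

section
/- Let G be a gyrogroup and let S ⊆ G be a symmetric subset with e ∉ S such that gyr[g,g'](S) = S for all g, g' ∈ G. Then the right Cayley graph RCay(G,S) is vertex-transitive: for any two vertices u, v ∈ G there exists a bijection φ : G → G with φ(u) = v such that for all x, y ∈ G, y is adjacent to x in RCay(G,S) if and only if φ(y) is adjacent to φ(x). -/
open Gyrogroup


namespace Gyrogroup

variable {G : Type*} [Gyrogroup G]

theorem add_left_bijective (a : G) : Function.Bijective (add a) := by
  constructor
  · intro x y h
    have h' := congrArg (add (neg a)) h
    rw [left_gyroassoc, left_gyroassoc, neg_add, e_add, e_add] at h'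
    exact (gyr_bijective _ _).injective h'
  · intro y
    obtain ⟨x, rfl⟩ := (gyr_bijective a (neg a)).surjective y
    exact ⟨add (neg a) x, by rw [left_gyroassoc, add_neg, e_add]⟩

/-- Left gyrotranslations preserve and reflect adjacency in the right Cayley graph of a
connection set that is stable under all gyroautomorphisms. -/
theorem exists_eq_add_iff_add_left {S : Set G} (hS : ∀ g g' : G, gyr g g' '' S = S)
    (a x y : G) :
    (∃ s ∈ S, y = add x s) ↔ ∃ s ∈ S, add a y = add (add a x) s := by
  constructor
  · rintro ⟨s, hs, rfl⟩
    exact ⟨gyr a x s, hS a x ▸ Set.mem_image_of_mem _ hs, left_gyroassoc a x s⟩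
  · rintro ⟨s, hs, h⟩
    obtain ⟨t, ht, rfl⟩ := (hS a x).symm ▸ hs
    rw [← left_gyroassoc] at h
    exact ⟨t, ht, (add_left_bijective a).injective h⟩

end Gyrogroup

/-- If `S` is symmetric, `e ∉ S`, and `gyr g g' '' S = S` for all `g, g' ∈ G`,
then the right Cayley graph `RCay(G,S)` is vertex-transitive. -/
theorem rcay_transitive_of_gyr_stable {G : Type*} [Gyrogroup G] (S : Set G)
    (hsym : ∀ s ∈ S, neg s ∈ S) (he : (e : G) ∉ S)
    (hgyr : ∀ g g' : G, gyr g g' '' S = S) :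
    ∀ u v : G, ∃ φ : G → G, Function.Bijective φ ∧ φ u = v ∧
      ∀ x y : G, (∃ s ∈ S, y = add x s) ↔ (∃ s ∈ S, φ y = add (φ x) s) := by
  intro u v
  let L := Equiv.ofBijective (add u) (add_left_bijective u)
  have hL : ∀ x, add u (L.symm x) = x := L.apply_symm_apply
  refine ⟨fun x => add v (L.symm x), (add_left_bijective v).comp L.symm.bijective, ?_, ?_⟩
  · have hu : L.symm u = e := L.symm_apply_eq.2 (add_e u).symm
    simp only [hu, add_e]
  · intro x y
    rw [← exists_eq_add_iff_add_left hgyr v, exists_eq_add_iff_add_left hgyr u (L.symm x), hL, hL]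
end

section
/- Let G be a gyrogroup, let S ⊆ G be a symmetric subset with e ∉ S, and let H be an L-subgyrogroup of G that is right-generated by S, such that gyr[g,h](S) = S for all g ∈ G and h ∈ H. If two vertices u and v lie in the same connected component of the right Cayley graph RCay(G,S) (i.e., there is a finite path of edges of RCay(G,S) from v to u), then u and v lie in the same left coset of H, i.e., there exists h ∈ H with u = v ⊕ h. -/
open Gyrogroup


/-- The set right-generated by `S`: all left-nested sums
`((⋯((s₁ ⊕ s₂) ⊕ s₃) ⊕ ⋯) ⊕ sₙ)` with `s₁, …, sₙ ∈ S`. -/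
inductive RightGen {G : Type*} [Gyrogroup G] (S : Set G) : G → Prop
  | base (s : G) (hs : s ∈ S) : RightGen S s
  | step (x : G) (hx : RightGen S x) (s : G) (hs : s ∈ S) : RightGen S (add x s)


/-- If `u` and `v` lie in the same connected component of `RCay(G,S)`, then they
lie in the same left coset of the L-subgyrogroup `H` right-generated by `S`. -/
theorem same_coset_of_rcay_connected {G : Type*} [Gyrogroup G] (S H : Set G)
    (hsym : ∀ s ∈ S, neg s ∈ S) (heS : (e : G) ∉ S)
    (hHe : (e : G) ∈ H)
    (hHadd : ∀ a ∈ H, ∀ b ∈ H, add a b ∈ H)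
    (hHneg : ∀ a ∈ H, neg a ∈ H)
    (hHgyr : ∀ a ∈ H, ∀ b ∈ H, gyr a b '' H = H)
    (hHL : ∀ a : G, ∀ h ∈ H, gyr a h '' H = H)
    (hgen : H = {x : G | RightGen S x})
    (hSgyr : ∀ g : G, ∀ h ∈ H, gyr g h '' S = S) :
    ∀ u v : G, Relation.ReflTransGen (fun a b => ∃ s ∈ S, b = add a s) v u →
      ∃ h ∈ H, u = add v h := by
  intro u v huv
  induction huv with
  | refl => exact ⟨e, hHe, (add_e v).symm⟩
  | tail _ hstep ih =>
    obtain ⟨h, hh, rfl⟩ := ih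
    obtain ⟨s, hs, rfl⟩ := hstep
    rw [← hSgyr v h hh] at hs
    obtain ⟨t, ht, rfl⟩ := hs
    have htH : t ∈ H := hgen ▸ RightGen.base t ht
    exact ⟨add h t, hHadd h hh t htH, (left_gyroassoc v h t).symm⟩
end

section
/- Let G be a gyrogroup, let S ⊆ G be a symmetric subset with e ∉ S, and let H be an L-subgyrogroup of G that is right-generated by S, such that gyr[g,h](S) = S for all g ∈ G and h ∈ H. If u and v lie in the same left coset of H, i.e., u = v ⊕ h for some h ∈ H, then u and v lie in the same connected component of the right Cayley graph RCay(G,S), i.e., there is a finite path of edges of RCay(G,S) from v to u. -/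
open Gyrogroup


/-- If `gyr v x` maps `S` into itself for every `x` right-generated by `S`, then the right Cayley
graph has a path from `v` to `v ⊕ h` for every `h` right-generated by `S`. -/
theorem RightGen.reflTransGen_add {G : Type*} [Gyrogroup G] {S : Set G} {v h : G}
    (hgyr : ∀ x, RightGen S x → ∀ s ∈ S, gyr v x s ∈ S) (hh : RightGen S h) :
    Relation.ReflTransGen (fun a b => ∃ s ∈ S, b = add a s) v (add v h) := by
  induction hh with
  | base s hs => exact .single ⟨s, hs, rfl⟩
  | step x hx s hs ih => exact ih.tail ⟨gyr v x s, hgyr x hx s hs, left_gyroassoc v x s⟩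

/-- If `u` and `v` lie in the same left coset of the L-subgyrogroup `H`
right-generated by `S`, then they lie in the same connected component of
`RCay(G,S)`. -/
theorem rcay_connected_of_same_coset {G : Type*} [Gyrogroup G] (S H : Set G)
    (hsym : ∀ s ∈ S, neg s ∈ S) (heS : (e : G) ∉ S)
    (hHe : (e : G) ∈ H)
    (hHadd : ∀ a ∈ H, ∀ b ∈ H, add a b ∈ H)
    (hHneg : ∀ a ∈ H, neg a ∈ H)
    (hHgyr : ∀ a ∈ H, ∀ b ∈ H, gyr a b '' H = H)
    (hHL : ∀ a : G, ∀ h ∈ H, gyr a h '' H = H)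
    (hgen : H = {x : G | RightGen S x})
    (hSgyr : ∀ g : G, ∀ h ∈ H, gyr g h '' S = S) :
    ∀ u v : G, (∃ h ∈ H, u = add v h) →
      Relation.ReflTransGen (fun a b => ∃ s ∈ S, b = add a s) v u := by
  rintro _ v ⟨h, hh, rfl⟩
  subst hgen
  exact RightGen.reflTransGen_add
    (fun x hx s hs => hSgyr v x hx ▸ Set.mem_image_of_mem (gyr v x) hs) hh
end
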